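/- For every μ ≥ 0 and every η > 0, r_{μ,η}(x#_{μ,η}) < 0; consequently, since r_{μ,η} has positive leading coefficient 12, the polynomial r_{μ,η} has a real root in (x#_{μ,η}, ∞), and its greatest positive real root x@_{μ,η} satisfies x@_{μ,η} > x#_{μ,η}. -/

import Mathlib

/-- `x#_{μ,η} := (1/2)·√(4μ² + η(η + 2) + √(η²(η + 2)² + 16μ²η))`. -/
noncomputable def xSharp (μ η : ℝ) : ℝ :=
  (1 / 2) * Real.sqrt (4 * μ ^ 2 + η * (η + 2)
    + Real.sqrt (η ^ 2 * (η + 2) ^ 2 + 16 * μ ^ 2 * η))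

/-- The polynomial `r_{μ,η}(x)` from the paper. -/
noncomputable def rPoly (μ η x : ℝ) : ℝ :=
  12 * x ^ 14
  + x ^ 12 * (-44 * μ ^ 2 + 4 * η * (η ^ 3 + 4 * η ^ 2 - 5 * η - 18))
  + x ^ 10 * (40 * μ ^ 4 + 8 * η * (-3 * η ^ 3 - 10 * η ^ 2 + 6 * η + 5) * μ ^ 2
      - η ^ 2 * (η + 2) ^ 2 * (4 * η ^ 2 + 8 * η - 3))
  + x ^ 8 * (40 * μ ^ 6 + 4 * η * (15 * η ^ 3 + 40 * η ^ 2 + 2 * η + 70) * μ ^ 4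
      + η ^ 2 * (20 * η ^ 4 + 96 * η ^ 3 + 147 * η ^ 2 + 96 * η + 52) * μ ^ 2
      + η ^ 4 * (η + 2) ^ 4)
  + x ^ 6 * (-100 * μ ^ 8 - 8 * η * (10 * η ^ 3 + 20 * η ^ 2 + 14 * η + 45) * μ ^ 6
      - η ^ 2 * (40 * η ^ 4 + 144 * η ^ 3 + 171 * η ^ 2 + 116 * η + 80) * μ ^ 4
      - 4 * η ^ 5 * (η + 2) ^ 3 * μ ^ 2)
  + x ^ 4 * (68 * μ ^ 10 + 4 * η * (15 * η ^ 3 + 20 * η ^ 2 + 27 * η + 20) * μ ^ 8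
      + η ^ 2 * (40 * η ^ 4 + 96 * η ^ 3 + 81 * η ^ 2 + 24 * η + 16) * μ ^ 6
      + 6 * η ^ 6 * (η + 2) ^ 2 * μ ^ 4)
  + x ^ 2 * (-16 * μ ^ 12 - 8 * η * (3 * η ^ 3 + 2 * η ^ 2 + 4 * η - 4) * μ ^ 10
      - 4 * η ^ 3 * (5 * η ^ 3 + 6 * η ^ 2 + 3 * η - 4) * μ ^ 8
      - 4 * η ^ 7 * (η + 2) * μ ^ 6)
  + (4 * η ^ 4 * μ ^ 12 + 4 * η ^ 6 * μ ^ 10 + η ^ 8 * μ ^ 8)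

/-- The values of `μ ^ 2` and `xSharp μ η ^ 2` are polynomial in `η` and a parameter `s ≥ 0`. -/
theorem xSharp_parametrization (μ η : ℝ) (hη : 0 < η) :
    ∃ s, 0 ≤ s ∧ μ ^ 2 = η * (η + 2 + 2 * s) / 2 * s ∧
      xSharp μ η ^ 2 = η * (η + 2 + 2 * s) / 2 * (1 + s) := by
  have hR : 0 ≤ η ^ 2 * (η + 2) ^ 2 + 16 * μ ^ 2 * η := by positivity
  have hS := Real.sq_sqrt hR
  have hle : η * (η + 2) ≤ √(η ^ 2 * (η + 2) ^ 2 + 16 * μ ^ 2 * η) := by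
    apply Real.le_sqrt_of_sq_le
    have : 0 ≤ 16 * μ ^ 2 * η := by positivity
    linarith [mul_pow η (η + 2) 2]
  have hx : xSharp μ η ^ 2 = (4 * μ ^ 2 + η * (η + 2)
      + √(η ^ 2 * (η + 2) ^ 2 + 16 * μ ^ 2 * η)) / 4 := by
    rw [xSharp, mul_pow, Real.sq_sqrt (by positivity)]
    ring
  set S := √(η ^ 2 * (η + 2) ^ 2 + 16 * μ ^ 2 * η)
  have hm : μ ^ 2 = (S ^ 2 - η ^ 2 * (η + 2) ^ 2) / (16 * η) := by
    rw [hS]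
    field_simp
    ring
  refine ⟨(S - η * (η + 2)) / (4 * η), div_nonneg (by linarith) (by positivity), ?_, ?_⟩
  · rw [hm]
    field_simp
    ring
  · rw [hx, hm]
    field_simp
    ring

theorem rPoly_eq_of_parametrization {μ η s x : ℝ} (hm : μ ^ 2 = η * (η + 2 + 2 * s) / 2 * s)
    (hx : x ^ 2 = η * (η + 2 + 2 * s) / 2 * (1 + s)) :
    rPoly μ η x = -(3 / 8 * η ^ 7 * (η + 2 + 2 * s) ^ 5 *
      (4 + 24 * s + 52 * s ^ 2 + 48 * s ^ 3 + 16 * s ^ 4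
        + η * (4 + 16 * s + 20 * s ^ 2 + 8 * s ^ 3) + η ^ 2 * (1 + s) ^ 2)) := by
  have ev (y : ℝ) (n : ℕ) : y ^ (2 * n) = (y ^ 2) ^ n := pow_mul y 2 n
  rw [rPoly, ev x 7, ev x 6, ev x 5, ev x 4, ev x 3, ev x 2, ev μ 6, ev μ 5, ev μ 4, ev μ 3,
    ev μ 2, hm, hx]
  ring

theorem continuous_rPoly (μ η : ℝ) : Continuous (rPoly μ η) := by
  unfold rPoly
  fun_prop

open Polynomial in
theorem tendsto_even_degree_fourteen_atTop (a b c d e f g : ℝ) :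
    Filter.Tendsto (fun x : ℝ => 12 * x ^ 14 + x ^ 12 * a + x ^ 10 * b + x ^ 8 * c + x ^ 6 * d
      + x ^ 4 * e + x ^ 2 * f + g) Filter.atTop Filter.atTop := by
  let P : ℝ[X] := C 12 * X ^ 14 + X ^ 12 * C a + X ^ 10 * C b + X ^ 8 * C c + X ^ 6 * C d
    + X ^ 4 * C e + X ^ 2 * C f + C g
  have hdeg : P.natDegree = 14 := by
    unfold P
    compute_degree!
  have hcoeff : P.coeff 14 = 12 := by
    unfold P
    compute_degree!
  have h := P.tendsto_atTop_of_leadingCoeff_nonneg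
    (natDegree_pos_iff_degree_pos.mp (by omega))
    (by rw [leadingCoeff, hdeg, hcoeff]; norm_num)
  simpa only [P, eval_add, eval_mul, eval_pow, eval_C, eval_X] using h

theorem tendsto_rPoly_atTop (μ η : ℝ) :
    Filter.Tendsto (rPoly μ η) Filter.atTop Filter.atTop :=
  tendsto_even_degree_fourteen_atTop _ _ _ _ _ _ _

/-- For every `μ ≥ 0` and `η > 0`, `r_{μ,η}(x#_{μ,η}) < 0`; consequently `r_{μ,η}` has a root
in `(x#_{μ,η}, ∞)`, and its greatest positive real root exceeds `x#_{μ,η}`. -/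
theorem rPoly_neg_at_xSharp (μ η : ℝ) (hμ : 0 ≤ μ) (hη : 0 < η) :
    rPoly μ η (xSharp μ η) < 0 ∧
    (∃ x, xSharp μ η < x ∧ rPoly μ η x = 0) ∧
    (∀ xAt, 0 < xAt → rPoly μ η xAt = 0 → (∀ y, 0 < y → rPoly μ η y = 0 → y ≤ xAt) →
      xSharp μ η < xAt) := by
  obtain ⟨s, hs, hm, hx⟩ := xSharp_parametrization μ η hη
  have hneg : rPoly μ η (xSharp μ η) < 0 := by
    rw [rPoly_eq_of_parametrization hm hx]
    exact neg_neg_of_pos (by positivity)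
  have hroot : ∃ x, xSharp μ η < x ∧ rPoly μ η x = 0 := by
    obtain ⟨b, hb, hpos⟩ := ((Filter.eventually_gt_atTop (xSharp μ η)).and
      ((tendsto_rPoly_atTop μ η).eventually_gt_atTop 0)).exists
    obtain ⟨x, hx, hx0⟩ := intermediate_value_Ioo hb.le (continuous_rPoly μ η).continuousOn
      ⟨hneg, hpos⟩
    exact ⟨x, hx.1, hx0⟩
  refine ⟨hneg, hroot, fun xAt _ _ hmax => ?_⟩
  obtain ⟨x, hlt, hx0⟩ := hroot
  have hnonneg : 0 ≤ xSharp μ η := by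
    unfold xSharp
    positivity
  exact hlt.trans_le (hmax x (hnonneg.trans_lt hlt) hx0)
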